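/- Let G be the finite metric graph with two vertices v and w, one edge e₁ of length π joining v and w, and one loop e₂ of length 1 attached at w. Then ker(−Δ_G − 4π²) is one-dimensional and is spanned by the function f with f_{e₁} = 0 identically and f_{e₂}(x) = sin(2πx) for x ∈ [0,1]; in particular R(G, 4π²) = ker(−Δ_G − 4π²), and consequently rank Res_{4π²} M_B = 0 for every nonempty set B of vertices of G, i.e., the eigenvalue 4π² is a removable singularity of the Titchmarsh–Weyl function M_B (invisible for M_B). -/

import Mathlib

open Real Set Filter Topology

noncomputable section

/-- A finite metric graph: finite vertex and edge sets, each edge `e` has an initial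
vertex `o e`, a terminal vertex `t e` and a positive length `L e`, and is identified
with the interval `[0, L e]`.  Every vertex is an endpoint of some edge. -/
structure MetricGraph where
  V : Type
  E : Type
  [fintV : Fintype V]
  [fintE : Fintype E]
  [decV : DecidableEq V]
  [decE : DecidableEq E]
  o : E → V
  t : E → V
  L : E → ℝ
  L_pos : ∀ e, 0 < L e
  noIsolated : ∀ v, ∃ e, o e = v ∨ t e = v

attribute [instance] MetricGraph.fintV MetricGraph.fintE MetricGraph.decV MetricGraph.decE

namespace MetricGraph

variable (G : MetricGraph)

/-- The source vertex of edge `e` traversed in direction `d`. -/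
def esrc (e : G.E) (d : Bool) : G.V := if d then G.o e else G.t e

/-- The destination vertex of edge `e` traversed in direction `d`. -/
def edst (e : G.E) (d : Bool) : G.V := if d then G.t e else G.o e

/-- A cycle in a metric graph: a closed walk which uses no edge twice and repeats no
vertex except that its initial and terminal vertices coincide. -/
structure Cycle where
  n : ℕ
  npos : 0 < n
  edge : Fin n → G.E
  dir : Fin n → Bool
  edge_inj : Function.Injective edge
  vert_inj : Function.Injective fun i => G.esrc (edge i) (dir i)
  chain : ∀ i : Fin n,
    G.edst (edge i) (dir i) =
      G.esrc (edge ⟨((i : ℕ) + 1) % n, Nat.mod_lt _ npos⟩)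
        (dir ⟨((i : ℕ) + 1) % n, Nat.mod_lt _ npos⟩)

/-- The length of a cycle: the sum of the lengths of its edges. -/
def Cycle.length {G : MetricGraph} (c : G.Cycle) : ℝ := ∑ i, G.L (c.edge i)

/-- The cycle `c` lies in the subgraph given by the edge set `S`. -/
def Cycle.inSub {G : MetricGraph} (c : G.Cycle) (S : Set G.E) : Prop := ∀ i, c.edge i ∈ S

/-- The cycle `c` has odd length with respect to `x`: its length is an odd multiple of `x`. -/
def Cycle.oddLength {G : MetricGraph} (c : G.Cycle) (x : ℝ) : Prop :=
  ∃ m : ℕ, Odd m ∧ c.length = m * x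

/-- The initial vertex of a cycle. -/
def Cycle.start {G : MetricGraph} (c : G.Cycle) : G.V :=
  G.esrc (c.edge ⟨0, c.npos⟩) (c.dir ⟨0, c.npos⟩)

/-- The vertices incident to an edge of the edge set `S`, i.e. the vertex set of the
subgraph generated by `S`. -/
def incVerts (S : Set G.E) : Set G.V := {v | ∃ e ∈ S, G.o e = v ∨ G.t e = v}

/-- Two vertices are related iff they are connected through edges of `S`. -/
def connRel (S : Set G.E) : G.V → G.V → Prop :=
  Relation.EqvGen fun v w => ∃ e ∈ S, G.o e = v ∧ G.t e = w

/-- The connected component of the vertex `v` in the subgraph given by `S`. -/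
def component (S : Set G.E) (v : G.V) : Set G.V := {w | G.connRel S v w}

/-- The number of connected components of the subgraph given by the edge set `S`. -/
def beta0 (S : Set G.E) : ℕ := (G.component S '' G.incVerts S).ncard

/-- The first Betti number `|E| - |V| + β₀` of the subgraph given by the edge set `S`. -/
def beta1 (S : Set G.E) : ℤ :=
  (S.ncard : ℤ) - ((G.incVerts S).ncard : ℤ) + (G.beta0 S : ℤ)

/-- The number of connected components of the subgraph given by `S` which contain a
cycle of odd length with respect to `x`. -/
def beta0odd (S : Set G.E) (x : ℝ) : ℕ :=
  (G.component S '' {v | v ∈ G.incVerts S ∧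
    ∃ c : G.Cycle, c.inSub S ∧ c.oddLength x ∧ G.connRel S v c.start}).ncard

/-- The edge set of the subgraph `G_λ`: all edges whose length is a positive integer
multiple of `π / √λ`. -/
def lamEdges (lam : ℝ) : Set G.E :=
  {e | ∃ k : ℕ, 0 < k ∧ G.L e = k * (π / Real.sqrt lam)}

/-- An edgewise given function is continuous at all the vertices of `G`. -/
def ContVert (f : G.E → ℝ → ℂ) : Prop :=
  (∀ e₁ e₂, G.o e₁ = G.o e₂ → f e₁ 0 = f e₂ 0) ∧
  (∀ e₁ e₂, G.o e₁ = G.t e₂ → f e₁ 0 = f e₂ (G.L e₂)) ∧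
  (∀ e₁ e₂, G.t e₁ = G.t e₂ → f e₁ (G.L e₁) = f e₂ (G.L e₂))

/-- The value of an (edgewise given, vertex-continuous) function at the vertex `v`. -/
def vtxVal (f : G.E → ℝ → ℂ) (v : G.V) : ℂ :=
  if h : ∃ e, G.o e = v then f h.choose 0
  else f (G.noIsolated v).choose (G.L ((G.noIsolated v).choose))

/-- `∂_ν f (v)`: the sum of the derivatives at the vertex `v` of the restrictions of
`f` to the edges incident to `v`, all pointing towards `v`. -/
def normDer (f : G.E → ℝ → ℂ) (v : G.V) : ℂ :=
  (∑ e ∈ Finset.univ.filter fun e => G.t e = v, deriv (f e) (G.L e)) -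
    ∑ e ∈ Finset.univ.filter fun e => G.o e = v, deriv (f e) 0

/-- `f` solves `-f'' = μ f` on every edge and is continuous at the vertices.
(A solution of `-f'' = μ f` on `[0, L e]` is identified with its unique extension to a
global solution on `ℝ`.) -/
def IsSol (mu : ℂ) (f : G.E → ℝ → ℂ) : Prop :=
  (∀ e, ContDiff ℝ 2 (f e)) ∧
  (∀ e, ∀ x : ℝ, deriv (deriv (f e)) x = -mu * f e x) ∧ G.ContVert f

/-- Membership in `ker (-Δ_G - λ)` for the Kirchhoff Laplacian `-Δ_G`. -/
def InKer (lam : ℝ) (f : G.E → ℝ → ℂ) : Prop :=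
  G.IsSol (lam : ℂ) f ∧ ∀ v, G.normDer f v = 0

/-- `ker (-Δ_G - λ)` as a set of (edgewise given) functions. -/
def kerSet (lam : ℝ) : Set (G.E → ℝ → ℂ) := {f | G.InKer lam f}

/-- `λ` is an eigenvalue of the Kirchhoff Laplacian `-Δ_G`. -/
def IsEigenvalue (lam : ℝ) : Prop := G.kerSet lam ≠ {0}

/-- `dim ker (-Δ_G - λ)`. -/
def dimKer (lam : ℝ) : ℕ := Module.finrank ℂ (Submodule.span ℂ (G.kerSet lam))

/-- The resonance eigenspace `R (G, λ)`: all elements of `ker (-Δ_G - λ)` vanishing at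
every vertex of `G`. -/
def resSet (lam : ℝ) : Set (G.E → ℝ → ℂ) :=
  {f | G.InKer lam f ∧ ∀ e, f e 0 = 0 ∧ f e (G.L e) = 0}

/-- `λ` is a (real) resonance of `G` iff `R (G, λ) ≠ {0}`. -/
def IsResonance (lam : ℝ) : Prop := G.resSet lam ≠ {0}

/-- `dim R (G, λ)`. -/
def dimRes (lam : ℝ) : ℕ := Module.finrank ℂ (Submodule.span ℂ (G.resSet lam))

/-- `R_B (G, λ)`: all elements of `ker (-Δ_G - λ)` vanishing at every vertex in `B`. -/
def resSetB (B : Set G.V) (lam : ℝ) : Set (G.E → ℝ → ℂ) :=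
  {f | G.InKer lam f ∧ ∀ e, (G.o e ∈ B → f e 0 = 0) ∧ (G.t e ∈ B → f e (G.L e) = 0)}

/-- `dim R_B (G, λ)`. -/
def dimResB (B : Set G.V) (lam : ℝ) : ℕ :=
  Module.finrank ℂ (Submodule.span ℂ (G.resSetB B lam))

/-- The degree of a vertex (a loop counts twice). -/
def degree (v : G.V) : ℕ := {e | G.o e = v}.ncard + {e | G.t e = v}.ncard

/-- The degree of a vertex inside the subgraph given by the edge set `S`. -/
def degreeIn (S : Set G.E) (v : G.V) : ℕ :=
  {e | e ∈ S ∧ G.o e = v}.ncard + {e | e ∈ S ∧ G.t e = v}.ncard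

/-- The edge set of the core of `G`: the largest subgraph without vertices of degree one. -/
def coreEdges : Set G.E := ⋃₀ {S : Set G.E | ∀ v, G.degreeIn S v ≠ 1}

/-- A boundary vertex is a vertex of degree one. -/
def IsBoundaryVertex (v : G.V) : Prop := G.degree v = 1

/-- A proper core vertex: all edges attached to it belong to the core of `G`. -/
def IsProperCoreVertex (v : G.V) : Prop :=
  ∀ e, G.o e = v ∨ G.t e = v → e ∈ G.coreEdges

/-- The defining property of the function `f^{(l)}` for the Titchmarsh--Weyl matrix:
`f` solves `-f'' = μ f` edgewise, is continuous at the vertices, and satisfies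
`∂_ν f (v₀) = 1` and `∂_ν f (v) = 0` for all vertices `v ≠ v₀`. -/
def IsTWsol (mu : ℂ) (v0 : G.V) (f : G.E → ℝ → ℂ) : Prop :=
  G.IsSol mu f ∧ G.normDer f v0 = 1 ∧ ∀ v, v ≠ v0 → G.normDer f v = 0

open scoped Classical in
/-- The Titchmarsh--Weyl matrix `M_B (μ)` with entries `(M_B (μ))_{k,l} = f^{(l)} (v_k)`
(defined via choice; junk if no `f^{(l)}` exists, i.e. at the eigenvalues). -/
def TW (B : Finset G.V) (mu : ℂ) : Matrix B B ℂ :=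
  Matrix.of fun k l : B => if h : ∃ f, G.IsTWsol mu l f then G.vtxVal h.choose k else 0

/-- The cycle `c` has commensurate edges: all ratios of edge lengths are rational. -/
def Commensurate (c : G.Cycle) : Prop :=
  ∀ i j, ∃ q : ℚ, G.L (c.edge i) = q * G.L (c.edge j)

/-- `u_C`: the maximal number such that the length of each edge of the cycle `c` is a
positive integer multiple of it. -/
def uC (c : G.Cycle) : ℝ :=
  sSup {u : ℝ | 0 < u ∧ ∀ i, ∃ k : ℕ, 0 < k ∧ G.L (c.edge i) = k * u}

/-- `λ_G := inf { π²/u_C² : C a cycle in G with commensurate edges }`, with value `+∞`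
if there is no cycle with commensurate edges. -/
def lamThreshold : EReal :=
  sInf {x : EReal | ∃ c : G.Cycle, G.Commensurate c ∧ x = ((π ^ 2 / (G.uC c) ^ 2 : ℝ) : EReal)}

end MetricGraph

section MatrixFun

variable {m : Type} [Fintype m]

/-- The matrix function `M` has a pole of order `n` at `λ`:
`lim_{z → λ} (z - λ)^n M(z)` exists and is nonzero, while
`lim_{z → λ} (z - λ)^(n+1) M(z) = 0`. -/
def hasPoleOrder (M : ℂ → Matrix m m ℂ) (lam : ℂ) (n : ℕ) : Prop :=
  (∃ A : Matrix m m ℂ, A ≠ 0 ∧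
    Filter.Tendsto (fun z => (z - lam) ^ n • M z) (𝓝[≠] lam) (𝓝 A)) ∧
  Filter.Tendsto (fun z => (z - lam) ^ (n + 1) • M z) (𝓝[≠] lam) (𝓝 0)

/-- `λ` is a pole of the matrix function `M`: `M` is analytic on a punctured
neighborhood of `λ` and has a pole of some order `n ≥ 1` at `λ`. -/
def isPole (M : ℂ → Matrix m m ℂ) (lam : ℂ) : Prop :=
  (∀ᶠ z in 𝓝[≠] lam, ∀ k l, AnalyticAt ℂ (fun w => M w k l) z) ∧
  ∃ n : ℕ, 1 ≤ n ∧ hasPoleOrder M lam n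

open scoped Classical in
/-- `Res_λ M := (2πi)⁻¹ ∮_Γ M(μ) dμ`, computed entrywise over a sufficiently small
positively oriented circle `Γ` centered at `λ` (defined via choice as the common value
of the circle integrals over all sufficiently small radii). -/
def matResidue (M : ℂ → Matrix m m ℂ) (lam : ℂ) : Matrix m m ℂ :=
  Matrix.of fun k l =>
    if h : ∃ c : ℂ, ∀ᶠ R in 𝓝[>] (0 : ℝ),
        (2 * (π : ℂ) * Complex.I)⁻¹ * circleIntegral (fun z => M z k l) lam R = c
    then h.choose else 0

end MatrixFun

/-- The metric graph of Example `ex:loop`: two vertices `v = 0` and `w = 1`, one edge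
`e₁ = 0` of length `π` from `v` to `w`, and one loop `e₂ = 1` of length `1` at `w`. -/
def loopGraph : MetricGraph where
  V := Fin 2
  E := Fin 2
  o := ![0, 1]
  t := ![1, 1]
  L := ![π, 1]
  L_pos := by
    intro e
    fin_cases e <;> simp [Real.pi_pos]
  noIsolated := by
    intro v
    fin_cases v
    · exact ⟨0, Or.inl rfl⟩
    · exact ⟨1, Or.inl rfl⟩

/-- The eigenfunction of Example `ex:loop`: `f_{e₁} = 0` and `f_{e₂}(x) = sin (2πx)`. -/
def loopEigenfun : Fin 2 → ℝ → ℂ :=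
  fun e x => if e = 0 then 0 else (Real.sin (2 * π * x) : ℂ)

/-- The solution of `-f'' = k² f` with `f 0 = a` and `f' 0 = b`. -/
def trigSol (k a b : ℂ) (x : ℝ) : ℂ := a * Complex.cos (k * x) + b * (Complex.sin (k * x) / k)

lemma hasDerivAt_cos_mul_ofReal (k : ℂ) (x : ℝ) :
    HasDerivAt (fun x : ℝ => Complex.cos (k * x)) (-k * Complex.sin (k * x)) x := by
  have h : HasDerivAt (fun z : ℂ => Complex.cos (k * z)) (-k * Complex.sin (k * x)) (x : ℂ) :=
    (((hasDerivAt_id (x : ℂ)).const_mul k).ccos).congr_deriv (by simp; ring)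
  exact h.comp_ofReal

lemma hasDerivAt_sin_mul_ofReal (k : ℂ) (x : ℝ) :
    HasDerivAt (fun x : ℝ => Complex.sin (k * x)) (k * Complex.cos (k * x)) x := by
  have h : HasDerivAt (fun z : ℂ => Complex.sin (k * z)) (k * Complex.cos (k * x)) (x : ℂ) :=
    (((hasDerivAt_id (x : ℂ)).const_mul k).csin).congr_deriv (by simp; ring)
  exact h.comp_ofReal

lemma hasDerivAt_trigSol {k : ℂ} (hk : k ≠ 0) (a b : ℂ) (x : ℝ) :
    HasDerivAt (trigSol k a b) (trigSol k b (-k ^ 2 * a) x) x := by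
  refine (((hasDerivAt_cos_mul_ofReal k x).const_mul a).add
    (((hasDerivAt_sin_mul_ofReal k x).div_const k).const_mul b)).congr_deriv ?_
  unfold trigSol
  field_simp
  ring

lemma deriv_trigSol {k : ℂ} (hk : k ≠ 0) (a b : ℂ) :
    deriv (trigSol k a b) = trigSol k b (-k ^ 2 * a) :=
  funext fun x => (hasDerivAt_trigSol hk a b x).deriv

lemma contDiff_trigSol (k a b : ℂ) : ContDiff ℝ 2 (trigSol k a b) := by
  have h : ContDiff ℝ 2 (fun x : ℝ => k * (x : ℂ)) :=
    contDiff_const.mul Complex.ofRealCLM.contDiff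
  have hc : ContDiff ℝ 2 Complex.cos := Complex.contDiff_cos.restrict_scalars ℝ
  have hs : ContDiff ℝ 2 Complex.sin := Complex.contDiff_sin.restrict_scalars ℝ
  exact (contDiff_const.mul (hc.comp h)).add (contDiff_const.mul ((hs.comp h).div_const k))

@[simp] lemma trigSol_zero (k a b : ℂ) : trigSol k a b 0 = a := by
  simp [trigSol]

lemma eq_trigSol {k : ℂ} (hk : k ≠ 0) {f : ℝ → ℂ} (hf : ContDiff ℝ 2 f)
    (hode : ∀ x, deriv (deriv f) x = -(k ^ 2) * f x) : f = trigSol k (f 0) (deriv f 0) := by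
  have hf₁ (x : ℝ) : HasDerivAt f (deriv f x) x :=
    (hf.differentiable (by norm_num) x).hasDerivAt
  have hf₂ (x : ℝ) : HasDerivAt (deriv f) (-(k ^ 2) * f x) x := by
    have h : ContDiff ℝ (1 + 1) f := by norm_num; exact hf
    rw [← hode x]
    exact ((contDiff_succ_iff_deriv.1 h).2.2.differentiable (by norm_num) x).hasDerivAt
  have hP (x : ℝ) : HasDerivAt
      (fun x : ℝ => f x * Complex.cos (k * x) - deriv f x * (Complex.sin (k * x) / k)) 0 x := by
    refine (((hf₁ x).mul (hasDerivAt_cos_mul_ofReal k x)).sub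
      ((hf₂ x).mul ((hasDerivAt_sin_mul_ofReal k x).div_const k))).congr_deriv ?_
    field_simp
    ring
  have hQ (x : ℝ) : HasDerivAt
      (fun x : ℝ => f x * (k * Complex.sin (k * x)) + deriv f x * Complex.cos (k * x)) 0 x := by
    refine (((hf₁ x).mul ((hasDerivAt_sin_mul_ofReal k x).const_mul k)).add
      ((hf₂ x).mul (hasDerivAt_cos_mul_ofReal k x))).congr_deriv ?_
    ring
  funext x
  have h₁ := is_const_of_deriv_eq_zero (fun y => (hP y).differentiableAt)
    (fun y => (hP y).deriv) x 0
  have h₂ := is_const_of_deriv_eq_zero (fun y => (hQ y).differentiableAt)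
    (fun y => (hQ y).deriv) x 0
  simp only [Complex.ofReal_zero, mul_zero, Complex.cos_zero, Complex.sin_zero, mul_one,
    zero_div, sub_zero, zero_add] at h₁ h₂
  unfold trigSol
  rw [← h₁, ← h₂]
  field_simp
  linear_combination (-f x * k) * Complex.sin_sq_add_cos_sq (k * x)

lemma forall_loopGraph {p : Fin 2 → Prop} : (∀ i, p i) ↔ p 0 ∧ p 1 := Fin.forall_fin_two

/-- Functions on the edges of `loopGraph`, as functions on `Fin 2`. -/
abbrev LoopFun := Fin 2 → ℝ → ℂ

lemma loopGraph_contVert_iff (f : LoopFun) :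
    loopGraph.ContVert f ↔ f 0 π = f 1 0 ∧ f 1 1 = f 1 0 := by
  constructor
  · rintro ⟨-, h, -⟩
    exact ⟨(h (1 : Fin 2) (0 : Fin 2) rfl).symm, (h (1 : Fin 2) (1 : Fin 2) rfl).symm⟩
  · rintro ⟨h₀, h₁⟩
    change (∀ i j : Fin 2, (![0, 1] : Fin 2 → Fin 2) i = (![0, 1] : Fin 2 → Fin 2) j →
        f i 0 = f j 0) ∧
      (∀ i j : Fin 2, (![0, 1] : Fin 2 → Fin 2) i = (![1, 1] : Fin 2 → Fin 2) j →
        f i 0 = f j ((![π, 1] : Fin 2 → ℝ) j)) ∧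
      (∀ i j : Fin 2, (![1, 1] : Fin 2 → Fin 2) i = (![1, 1] : Fin 2 → Fin 2) j →
        f i ((![π, 1] : Fin 2 → ℝ) i) = f j ((![π, 1] : Fin 2 → ℝ) j))
    simp [Fin.forall_fin_two, h₀, h₁]

lemma loopGraph_normDer_zero (f : LoopFun) :
    loopGraph.normDer f (0 : Fin 2) = -deriv (f 0) 0 := by
  change (∑ e ∈ Finset.univ.filter fun e : Fin 2 => (![1, 1] : Fin 2 → Fin 2) e = 0,
      deriv (f e) ((![π, 1] : Fin 2 → ℝ) e)) -
    (∑ e ∈ Finset.univ.filter fun e : Fin 2 => (![0, 1] : Fin 2 → Fin 2) e = 0,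
      deriv (f e) 0) = _
  simp [Finset.sum_filter, Fin.sum_univ_two]

lemma loopGraph_normDer_one (f : LoopFun) :
    loopGraph.normDer f (1 : Fin 2) = deriv (f 0) π + deriv (f 1) 1 - deriv (f 1) 0 := by
  change (∑ e ∈ Finset.univ.filter fun e : Fin 2 => (![1, 1] : Fin 2 → Fin 2) e = 1,
      deriv (f e) ((![π, 1] : Fin 2 → ℝ) e)) -
    (∑ e ∈ Finset.univ.filter fun e : Fin 2 => (![0, 1] : Fin 2 → Fin 2) e = 1,
      deriv (f e) 0) = _
  simp [Finset.sum_filter, Fin.sum_univ_two]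

lemma loopGraph_vtxVal (f : LoopFun) (v : Fin 2) : loopGraph.vtxVal f v = f v 0 := by
  have ho (e : Fin 2) : loopGraph.o e = e := by
    fin_cases e <;> rfl
  have h : ∃ e, loopGraph.o e = v := ⟨v, ho v⟩
  have hv : h.choose = v := (ho h.choose).symm.trans h.choose_spec
  unfold MetricGraph.vtxVal
  rw [dif_pos h, hv]

/-- Solutions on `loopGraph` in terms of their initial data on the two edges. -/
lemma loopGraph_isSol_iff {k : ℂ} (hk : k ≠ 0) (f : LoopFun) :
    loopGraph.IsSol (k ^ 2) f ↔ ∃ a a' b b' : ℂ,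
      f 0 = trigSol k a a' ∧ f 1 = trigSol k b b' ∧
      trigSol k a a' π = b ∧ trigSol k b b' 1 = b := by
  constructor
  · rintro ⟨hC, hode, hV⟩
    obtain ⟨h₀, h₁⟩ := (loopGraph_contVert_iff f).1 hV
    have e₀ := eq_trigSol hk (hC (0 : Fin 2)) (hode (0 : Fin 2))
    have e₁ := eq_trigSol hk (hC (1 : Fin 2)) (hode (1 : Fin 2))
    exact ⟨_, _, _, _, e₀, e₁, by rw [← e₀, h₀], by rw [← e₁, h₁]⟩
  · rintro ⟨a, a', b, b', e₀, e₁, h₀, h₁⟩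
    refine ⟨forall_loopGraph.2 ?_, forall_loopGraph.2 ?_, (loopGraph_contVert_iff f).2 ?_⟩
    · rw [e₀, e₁]
      exact ⟨contDiff_trigSol _ _ _, contDiff_trigSol _ _ _⟩
    · rw [e₀, e₁]
      simp only [deriv_trigSol hk]
      constructor <;> intro x <;> simp only [trigSol] <;> ring
    · rw [e₀, e₁]
      simpa using ⟨h₀, h₁⟩

/-- The secular function of `loopGraph`, up to factors vanishing only at resonances. -/
def loopDen (k : ℂ) : ℂ :=
  k * (Complex.cos (k / 2) * Complex.sin (k * π) + 2 * Complex.sin (k / 2) * Complex.cos (k * π))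

/-- The entries of the Titchmarsh--Weyl matrix of `loopGraph` at `k²`. -/
def loopTW (k : ℂ) : Matrix (Fin 2) (Fin 2) ℂ :=
  (loopDen k)⁻¹ • !![2 * Complex.sin (k / 2) * Complex.sin (k * π) -
      Complex.cos (k / 2) * Complex.cos (k * π), -Complex.cos (k / 2);
    -Complex.cos (k / 2), -Complex.cos (k / 2) * Complex.cos (k * π)]

lemma cos_eq_half (k : ℂ) : Complex.cos k = 1 - 2 * Complex.sin (k / 2) ^ 2 := by
  have := Complex.cos_two_mul (k / 2)
  rw [mul_div_cancel₀ k two_ne_zero] at this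
  linear_combination this + 2 * Complex.sin_sq_add_cos_sq (k / 2)

lemma sin_eq_half (k : ℂ) : Complex.sin k = 2 * Complex.sin (k / 2) * Complex.cos (k / 2) := by
  have := Complex.sin_two_mul (k / 2)
  rwa [mul_div_cancel₀ k two_ne_zero] at this

lemma loopGraph_vertex_values {k : ℂ} (hk : k ≠ 0) (hS : Complex.sin (k / 2) ≠ 0)
    (hD : loopDen k ≠ 0) {f : LoopFun} (hf : loopGraph.IsSol (k ^ 2) f) (i : Fin 2) :
    f i 0 = loopTW k i 0 * loopGraph.normDer f (0 : Fin 2) +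
      loopTW k i 1 * loopGraph.normDer f (1 : Fin 2) := by
  obtain ⟨a, a', b, b', e₀, e₁, h₀, h₁⟩ := (loopGraph_isSol_iff hk f).1 hf
  rw [loopGraph_normDer_zero, loopGraph_normDer_one, e₀, e₁]
  simp only [deriv_trigSol hk, trigSol_zero]
  simp only [trigSol, Complex.ofReal_one, mul_one] at h₀ h₁ ⊢
  rw [cos_eq_half k, sin_eq_half k] at h₁ ⊢
  have hP := Complex.sin_sq_add_cos_sq (k * π)
  have hQ := Complex.sin_sq_add_cos_sq (k / 2)
  have hb : b' * Complex.cos (k / 2) = b * k * Complex.sin (k / 2) := by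
    field_simp at h₁
    apply mul_left_cancel₀ hS
    linear_combination h₁ / 2
  have hn : a' * Complex.cos (k * π) + -k ^ 2 * a * (Complex.sin (k * π) / k) +
      (b' * (1 - 2 * Complex.sin (k / 2) ^ 2) +
        -k ^ 2 * b * (2 * Complex.sin (k / 2) * Complex.cos (k / 2) / k)) - b' =
      a' * Complex.cos (k * π) - k * a * Complex.sin (k * π) -
        2 * Complex.sin (k / 2) ^ 2 * b' -
        2 * k * b * Complex.sin (k / 2) * Complex.cos (k / 2) := by
    field_simp
    ring
  have hkb : k * b = k * a * Complex.cos (k * π) + a' * Complex.sin (k * π) := by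
    rw [← h₀]
    field_simp
  rw [hn]
  generalize hn₁ : a' * Complex.cos (k * π) - k * a * Complex.sin (k * π) -
        2 * Complex.sin (k / 2) ^ 2 * b' -
        2 * k * b * Complex.sin (k / 2) * Complex.cos (k / 2) = n
  have ha_den : loopDen k * a = (2 * Complex.sin (k / 2) * Complex.sin (k * π) -
      Complex.cos (k / 2) * Complex.cos (k * π)) * -a' - Complex.cos (k / 2) * n := by
    rw [← hn₁, loopDen]
    linear_combination (-2 * Complex.sin (k / 2)) * hkb -
      2 * Complex.sin (k / 2) ^ 2 * hb - 2 * Complex.sin (k / 2) * k * b * hQ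
  have hb_den : loopDen k * b =
      Complex.cos (k / 2) * a' - Complex.cos (k / 2) * Complex.cos (k * π) * n := by
    unfold loopDen at ha_den ⊢
    linear_combination (Complex.cos (k / 2) * Complex.sin (k * π) +
      2 * Complex.sin (k / 2) * Complex.cos (k * π)) * hkb + Complex.cos (k * π) * ha_den +
      Complex.cos (k / 2) * a' * hP
  revert i
  rw [Fin.forall_fin_two, e₀, e₁, trigSol_zero, trigSol_zero]
  refine ⟨mul_left_cancel₀ hD ?_, mul_left_cancel₀ hD ?_⟩
  · rw [ha_den]
    simp [loopTW]
    field_simp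
    ring
  · rw [hb_den]
    simp [loopTW]
    field_simp
    ring

lemma loopGraph_exists_isSol {k : ℂ} (hk : k ≠ 0) (hC : Complex.cos (k / 2) ≠ 0)
    (hD : loopDen k ≠ 0) (d₀ d₁ : ℂ) : ∃ f : LoopFun, loopGraph.IsSol (k ^ 2) f ∧
      loopGraph.normDer f (0 : Fin 2) = d₀ ∧ loopGraph.normDer f (1 : Fin 2) = d₁ := by
  set a : ℂ := loopTW k 0 0 * d₀ + loopTW k 0 1 * d₁ with ha
  set b : ℂ := loopTW k 1 0 * d₀ + loopTW k 1 1 * d₁ with hb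
  have hP := Complex.sin_sq_add_cos_sq (k * π)
  have hQ := Complex.sin_sq_add_cos_sq (k / 2)
  have ha_den : loopDen k * a = (2 * Complex.sin (k / 2) * Complex.sin (k * π) -
      Complex.cos (k / 2) * Complex.cos (k * π)) * d₀ - Complex.cos (k / 2) * d₁ := by
    rw [ha]
    simp [loopTW]
    field_simp
    ring
  have hb_den : loopDen k * b =
      -Complex.cos (k / 2) * d₀ - Complex.cos (k / 2) * Complex.cos (k * π) * d₁ := by
    rw [hb]
    simp [loopTW]
    field_simp
    ring
  have hkb : k * b = k * a * Complex.cos (k * π) - d₀ * Complex.sin (k * π) := by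
    apply mul_left_cancel₀ hD
    have := hb_den
    rw [show loopDen k = k * (Complex.cos (k / 2) * Complex.sin (k * π) +
      2 * Complex.sin (k / 2) * Complex.cos (k * π)) from rfl] at this ha_den ⊢
    linear_combination k * this - k * Complex.cos (k * π) * ha_den +
      k * Complex.cos (k / 2) * d₀ * hP
  refine ⟨![trigSol k a (-d₀), trigSol k b (b * k * Complex.sin (k / 2) / Complex.cos (k / 2))],
    (loopGraph_isSol_iff hk _).2 ⟨_, _, _, _, rfl, rfl, ?_, ?_⟩, ?_, ?_⟩
  · apply mul_left_cancel₀ hk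
    rw [hkb, trigSol]
    field_simp
    ring
  · rw [trigSol, Complex.ofReal_one, mul_one, cos_eq_half k, sin_eq_half k]
    field_simp
    ring
  · rw [loopGraph_normDer_zero]
    simp [deriv_trigSol hk]
  · rw [loopGraph_normDer_one]
    simp only [Matrix.cons_val_zero, Matrix.cons_val_one, deriv_trigSol hk, trigSol_zero]
    rw [trigSol, trigSol, Complex.ofReal_one, mul_one, cos_eq_half k, sin_eq_half k]
    apply mul_left_cancel₀ hC
    unfold loopDen at ha_den
    field_simp
    linear_combination -ha_den - 2 * Complex.sin (k / 2) * hkb -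
      2 * k * b * Complex.sin (k / 2) * hQ

lemma loopGraph_tw {k : ℂ} (hk : k ≠ 0) (hS : Complex.sin (k / 2) ≠ 0)
    (hC : Complex.cos (k / 2) ≠ 0) (hD : loopDen k ≠ 0) (B : Finset loopGraph.V) (i j : B) :
    loopGraph.TW B (k ^ 2) i j = loopTW k i.1 j.1 := by
  obtain ⟨i : Fin 2, hi⟩ := i
  obtain ⟨j : Fin 2, hj⟩ := j
  have hj' : j = 0 ∨ j = 1 := by
    fin_cases j <;> simp
  have hex : ∃ f : LoopFun, loopGraph.IsTWsol (k ^ 2) j f := by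
    rcases hj' with rfl | rfl
    · obtain ⟨f, hf, h₀, h₁⟩ := loopGraph_exists_isSol hk hC hD 1 0
      exact ⟨f, hf, h₀, forall_loopGraph.2 ⟨fun h => absurd rfl h, fun _ => h₁⟩⟩
    · obtain ⟨f, hf, h₀, h₁⟩ := loopGraph_exists_isSol hk hC hD 0 1
      exact ⟨f, hf, h₁, forall_loopGraph.2 ⟨fun _ => h₀, fun h => absurd rfl h⟩⟩
  have key (f : LoopFun) (hf : loopGraph.IsTWsol (k ^ 2) j f) :
      loopGraph.vtxVal f i = loopTW k i j := by
    rw [loopGraph_vtxVal, loopGraph_vertex_values hk hS hD hf.1]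
    obtain ⟨-, h₁, h₀⟩ := hf
    rcases hj' with rfl | rfl
    · rw [h₁, h₀ (1 : Fin 2) (one_ne_zero (α := Fin 2)), mul_one, mul_zero, add_zero]
    · rw [h₁, h₀ (0 : Fin 2) (zero_ne_one (α := Fin 2)), mul_one, mul_zero, zero_add]
  exact (dif_pos hex).trans (key _ hex.choose_spec)

lemma sin_two_pi_mul_pi_ne_zero : Complex.sin (2 * π * π) ≠ 0 := by
  have h : Real.sin (2 * π * π) ≠ 0 := by
    rw [Ne, Real.sin_eq_zero_iff]
    rintro ⟨n, hn⟩
    have h2 : (n : ℝ) = 2 * π := mul_right_cancel₀ Real.pi_ne_zero hn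
    exact (irrational_pi.ratCast_mul (q := 2) two_ne_zero).ne_int n (by push_cast; exact h2.symm)
  exact_mod_cast h

lemma two_pi_ne_zero : (2 * π : ℂ) ≠ 0 :=
  mul_ne_zero two_ne_zero (Complex.ofReal_ne_zero.2 Real.pi_ne_zero)

lemma mem_loopGraph_kerSet_iff (f : LoopFun) : f ∈ loopGraph.kerSet (4 * π ^ 2) ↔
    (∃ a a' b b' : ℂ, f 0 = trigSol (2 * π) a a' ∧ f 1 = trigSol (2 * π) b b' ∧
      trigSol (2 * π) a a' π = b ∧ trigSol (2 * π) b b' 1 = b) ∧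
    -deriv (f 0) 0 = 0 ∧ deriv (f 0) π + deriv (f 1) 1 - deriv (f 1) 0 = 0 := by
  have hlam : ((4 * π ^ 2 : ℝ) : ℂ) = (2 * π : ℂ) ^ 2 := by
    push_cast
    ring
  rw [← loopGraph_normDer_zero, ← loopGraph_normDer_one, ← loopGraph_isSol_iff two_pi_ne_zero,
    ← hlam]
  exact and_congr Iff.rfl forall_loopGraph

lemma loopGraph_kerSet : loopGraph.kerSet (4 * π ^ 2) =
    {g | ∃ c : ℂ, g = c • (loopEigenfun : LoopFun)} := by
  have hk := two_pi_ne_zero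
  ext f
  refine (mem_loopGraph_kerSet_iff f).trans ?_
  change _ ↔ ∃ c : ℂ, f = c • (loopEigenfun : LoopFun)
  constructor
  · rintro ⟨⟨a, a', b, b', e₀, e₁, h₀, h₁⟩, hn₀, hn₁⟩
    rw [e₀, deriv_trigSol hk, trigSol_zero, neg_eq_zero] at hn₀
    subst hn₀
    rw [e₀, e₁, deriv_trigSol hk, deriv_trigSol hk, trigSol_zero] at hn₁
    simp only [trigSol, Complex.ofReal_one, mul_one, Complex.cos_two_pi, Complex.sin_two_pi,
      zero_mul, zero_div, mul_zero, add_zero, zero_add, add_sub_cancel_right] at hn₁ h₀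
    have ha : a = 0 := by
      simpa [hk, sin_two_pi_mul_pi_ne_zero] using hn₁
    subst ha
    rw [zero_mul] at h₀
    subst h₀
    refine ⟨b' / (2 * π), funext (Fin.forall_fin_two.2 ⟨?_, ?_⟩)⟩
    · rw [e₀]
      funext x
      simp [trigSol, loopEigenfun]
    · rw [e₁]
      funext x
      simp [trigSol, loopEigenfun]
      ring
  · rintro ⟨c, rfl⟩
    have e₀ : (c • loopEigenfun) 0 = trigSol (2 * π) 0 0 := by
      funext x
      simp [trigSol, loopEigenfun]
    have e₁ : (c • loopEigenfun) 1 = trigSol (2 * π) 0 (c * (2 * π)) := by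
      funext x
      simp only [trigSol, mul_assoc c, mul_div_cancel₀ _ hk]
      simp [loopEigenfun]
    refine ⟨⟨_, _, _, _, e₀, e₁, ?_, ?_⟩, ?_, ?_⟩
    · simp [trigSol]
    · simp [trigSol]
    · rw [e₀, deriv_trigSol hk]
      simp
    · rw [e₀, e₁, deriv_trigSol hk, deriv_trigSol hk]
      simp [trigSol]

lemma loopEigenfun_ne_zero : loopEigenfun ≠ 0 := by
  intro h
  have := congrFun (congrFun h 1) (1 / 4)
  simp only [loopEigenfun, one_ne_zero, if_false, Pi.zero_apply, Complex.ofReal_eq_zero] at this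
  rw [show 2 * π * (1 / 4) = π / 2 by ring, Real.sin_pi_div_two] at this
  exact one_ne_zero this

/-- If every entry extends analytically across `lam`, the residue at `lam` vanishes. -/
lemma matResidue_eq_zero {m : Type} [Fintype m] {M N : ℂ → Matrix m m ℂ} {lam : ℂ}
    (hN : ∀ k l, AnalyticAt ℂ (fun z => N z k l) lam) (h : ∀ᶠ z in 𝓝[≠] lam, N z = M z) :
    matResidue M lam = 0 := by
  have hM (k l : m) : ∀ᶠ R in 𝓝[>] (0 : ℝ),
      (2 * (π : ℂ) * Complex.I)⁻¹ * circleIntegral (fun z => M z k l) lam R = 0 := by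
    obtain ⟨r, hr, hrN⟩ := Metric.eventually_nhds_iff_ball.1
      ((hN k l).eventually_analyticAt.and (eventually_nhdsWithin_iff.1 h))
    filter_upwards [Ioo_mem_nhdsGT hr] with R hR
    have hsub {z : ℂ} (hz : z ∈ Metric.closedBall lam R) : z ∈ Metric.ball lam r :=
      Metric.closedBall_subset_ball hR.2 hz
    have hcongr : circleIntegral (fun z => M z k l) lam R =
        circleIntegral (fun z => N z k l) lam R := by
      refine circleIntegral.integral_congr hR.1.le fun z hz => ?_
      have hz' : z ≠ lam := by
        rintro rfl
        simp [hR.1.ne] at hz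
      exact congrFun (congrFun ((hrN z (hsub (Metric.sphere_subset_closedBall hz))).2 hz') k) l
        |>.symm
    rw [hcongr, Complex.circleIntegral_eq_zero_of_differentiable_on_off_countable hR.1.le
      Set.countable_empty, mul_zero]
    · exact fun z hz => (hrN z (hsub hz)).1.continuousAt.continuousWithinAt
    · exact fun z hz => (hrN z (hsub (Metric.ball_subset_closedBall hz.1))).1.differentiableAt
  ext k l
  have hex : ∃ c : ℂ, ∀ᶠ R in 𝓝[>] (0 : ℝ),
      (2 * (π : ℂ) * Complex.I)⁻¹ * circleIntegral (fun z => M z k l) lam R = c := ⟨0, hM k l⟩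
  unfold matResidue
  rw [Matrix.of_apply]
  refine (dif_pos hex).trans ?_
  obtain ⟨R, hR, hR'⟩ := (hex.choose_spec.and (hM k l)).exists
  exact hR.symm.trans hR'

lemma loopDen_two_pi_ne_zero : loopDen (2 * π) ≠ 0 := by
  have h : (2 * π : ℂ) / 2 = π := mul_div_cancel_left₀ _ two_ne_zero
  simp [loopDen, h, sin_two_pi_mul_pi_ne_zero]

lemma analyticAt_loopTW {k : ℂ} (hD : loopDen k ≠ 0) (i j : Fin 2) :
    AnalyticAt ℂ (fun z => loopTW z i j) k := by
  have hden : AnalyticAt ℂ (fun z => (loopDen z)⁻¹) k := by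
    refine AnalyticAt.inv ?_ hD
    unfold loopDen
    fun_prop
  revert i j
  simp only [Fin.forall_fin_two, loopTW, Matrix.smul_apply, smul_eq_mul, Matrix.of_apply,
    Matrix.cons_val', Matrix.cons_val_zero, Matrix.cons_val_one, Matrix.cons_val_fin_one]
  refine ⟨⟨hden.mul ?_, hden.mul ?_⟩, hden.mul ?_, hden.mul ?_⟩ <;> fun_prop

/-- A local analytic square root near `4π²`, with the value `2π` there. -/
lemma exists_analytic_sqrt : ∃ s : ℂ → ℂ, AnalyticAt ℂ s ((4 * π ^ 2 : ℝ) : ℂ) ∧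
    s ((4 * π ^ 2 : ℝ) : ℂ) = 2 * π ∧ ∀ z, s z ^ 2 = z := by
  refine ⟨fun z => z ^ (1 / 2 : ℂ), ?_, ?_, fun z => ?_⟩
  · refine analyticAt_id.cpow analyticAt_const ?_
    exact Complex.ofReal_mem_slitPlane.2 (by positivity)
  · have h : ((4 * π ^ 2 : ℝ) : ℂ) = ((2 * π : ℝ) : ℂ) ^ 2 := by
      push_cast
      ring
    have := Complex.ofReal_cpow (x := 4 * π ^ 2) (by positivity) (1 / 2)
    push_cast at this ⊢
    rw [← this, ← Real.sqrt_eq_rpow, show 4 * π ^ 2 = (2 * π) ^ 2 by ring,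
      Real.sqrt_sq (by positivity)]
    push_cast
    rfl
  · rw [← Complex.cpow_nat_mul]
    simp

lemma loopGraph_tw_extends (B : Finset loopGraph.V) : ∃ N : ℂ → Matrix B B ℂ,
    (∀ k l : B, AnalyticAt ℂ (fun z => N z k l) ((4 * π ^ 2 : ℝ) : ℂ)) ∧
    ∀ᶠ z in 𝓝[≠] ((4 * π ^ 2 : ℝ) : ℂ), N z = loopGraph.TW B z := by
  obtain ⟨s, hs, hs₀, hsq⟩ := exists_analytic_sqrt
  set lam : ℂ := ((4 * π ^ 2 : ℝ) : ℂ) with hlam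
  have hhalf : s lam / 2 = π := by
    rw [hs₀]
    exact mul_div_cancel_left₀ _ two_ne_zero
  refine ⟨fun z => Matrix.of fun i j => loopTW (s z) i.1 j.1, fun i j => ?_, ?_⟩
  · have h : AnalyticAt ℂ (fun z => loopTW z i.1 j.1) (s lam) :=
      analyticAt_loopTW (hs₀ ▸ loopDen_two_pi_ne_zero) _ _
    exact h.comp hs
  · have hk : ∀ᶠ z in 𝓝 lam, s z ≠ 0 :=
      hs.continuousAt.eventually_ne (hs₀ ▸ two_pi_ne_zero)
    have hC : ∀ᶠ z in 𝓝 lam, Complex.cos (s z / 2) ≠ 0 := by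
      have h : AnalyticAt ℂ (fun z => Complex.cos (s z / 2)) lam := by fun_prop
      exact h.continuousAt.eventually_ne (by simp [hhalf])
    have hD : ∀ᶠ z in 𝓝 lam, loopDen (s z) ≠ 0 := by
      have h : AnalyticAt ℂ (fun z => loopDen (s z)) lam := by
        unfold loopDen
        fun_prop
      exact h.continuousAt.eventually_ne (hs₀ ▸ loopDen_two_pi_ne_zero)
    have hS : ∀ᶠ z in 𝓝[≠] lam, Complex.sin (s z / 2) ≠ 0 := by
      have hd := hs.differentiableAt.hasDerivAt
      have hone : 2 * s lam * deriv s lam = 1 := by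
        have h := hd.pow 2
        rw [show s ^ 2 = id from funext hsq] at h
        simpa using h.unique (hasDerivAt_id lam)
      refine (hd.div_const 2).csin.eventually_ne ?_
      rw [hhalf, Complex.cos_pi]
      have : deriv s lam ≠ 0 := right_ne_zero_of_mul_eq_one hone
      simpa using this
    filter_upwards [hS, eventually_nhdsWithin_of_eventually_nhds hk,
      eventually_nhdsWithin_of_eventually_nhds hC,
      eventually_nhdsWithin_of_eventually_nhds hD] with z hS hk hC hD
    ext i j
    have h := loopGraph_tw hk hS hC hD B i j
    rw [hsq] at h
    exact h.symm

lemma finrank_span_setOf_smul {W : Type*} [AddCommGroup W] [Module ℂ W] {v : W} (hv : v ≠ 0) :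
    Module.finrank ℂ (Submodule.span ℂ {g | ∃ c : ℂ, g = c • v}) = 1 := by
  have h : Submodule.span ℂ {g | ∃ c : ℂ, g = c • v} = Submodule.span ℂ {v} := by
    refine le_antisymm (Submodule.span_le.2 ?_) (Submodule.span_mono ?_)
    · rintro _ ⟨c, rfl⟩
      exact Submodule.smul_mem _ c (Submodule.mem_span_singleton_self _)
    · rintro _ rfl
      exact ⟨1, (one_smul _ _).symm⟩
  rw [h, finrank_span_singleton hv]

/-- Example `ex:loop`: for the loop graph, `ker(-Δ_G - 4π²)` is
one-dimensional and spanned by `f` with `f_{e₁} = 0`, `f_{e₂}(x) = sin(2πx)`; in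
particular `R(G, 4π²) = ker(-Δ_G - 4π²)`, and consequently for every nonempty vertex
set `B` the residue of `M_B` at `4π²` vanishes (has rank `0`), i.e. `4π²` is a
removable singularity of `M_B` — the eigenvalue `4π²` is invisible for `M_B`. -/
theorem statement_17 :
    loopGraph.dimKer (4 * π ^ 2) = 1 ∧
    loopGraph.kerSet (4 * π ^ 2) = {g | ∃ c : ℂ, g = c • (loopEigenfun : loopGraph.E → ℝ → ℂ)} ∧
    loopGraph.resSet (4 * π ^ 2) = loopGraph.kerSet (4 * π ^ 2) ∧
    ∀ B : Finset loopGraph.V, B.Nonempty →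
      matResidue (loopGraph.TW B) ((4 * π ^ 2 : ℝ) : ℂ) = 0 ∧
      (matResidue (loopGraph.TW B) ((4 * π ^ 2 : ℝ) : ℂ)).rank = 0 ∧
      ∃ N : ℂ → Matrix B B ℂ,
        (∀ k l : B, AnalyticAt ℂ (fun z => N z k l) ((4 * π ^ 2 : ℝ) : ℂ)) ∧
        ∀ᶠ z in 𝓝[≠] ((4 * π ^ 2 : ℝ) : ℂ), N z = loopGraph.TW B z := by
  refine ⟨?_, loopGraph_kerSet, ?_, fun B _ => ?_⟩
  · unfold MetricGraph.dimKer
    rw [loopGraph_kerSet]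
    exact finrank_span_setOf_smul loopEigenfun_ne_zero
  · refine Set.Subset.antisymm (fun f hf => hf.1) fun f hf => ⟨hf, ?_⟩
    rw [loopGraph_kerSet] at hf
    obtain ⟨c, rfl⟩ := hf
    refine forall_loopGraph.2 ⟨⟨?_, ?_⟩, ?_, ?_⟩
    · simp [loopEigenfun]
    · simp [loopEigenfun]
    · simp [loopEigenfun]
    · simp [loopEigenfun, loopGraph]
  · obtain ⟨N, hN, h⟩ := loopGraph_tw_extends B
    have hres := matResidue_eq_zero hN h
    refine ⟨hres, ?_, N, hN, h⟩
    rw [hres, Matrix.rank_zero]
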